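/- Let A be a set of labels with a chosen element $ ∈ A, and consider the signature with one constant C and one unary operation symbol q. Let ρ be the biGSOS law defined by: ρ_X(C) = ($, q(C)), and for every stream σ = x0 →a0 x1 →a1 x2 →a2 ⋯ ∈ B^∞X, ρ_X(q(σ)) = (a1, q(x2)). Then there exists no distributive law λ that extends ρ. -/

import Mathlib

/-- Σ-terms over a signature: `Op` is the set of operation symbols, `ar` the arity. -/
inductive Term (Op : Type) (ar : Op → ℕ) (X : Type) : Type
  | var : X → Term Op ar X
  | op : (o : Op) → (Fin (ar o) → Term Op ar X) → Term Op ar X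

namespace Term
variable {Op : Type} {ar : Op → ℕ}

/-- Functorial action of `Σ*` (term substitution of variables). -/
def map {X Y : Type} (f : X → Y) : Term Op ar X → Term Op ar Y
  | var x => var (f x)
  | op o ts => op o fun i => (ts i).map f

/-- Multiplication `μ` of the free monad: flattening of terms of terms. -/
def join {X : Type} : Term Op ar (Term Op ar X) → Term Op ar X
  | var t => t
  | op o ts => op o fun i => (ts i).join

end Term

/-- Comultiplication `δ` of the cofree comonad on `B X = A × X`:
color each position of a stream with the tail starting there. -/
def sTails {A X : Type} (σ : Stream' (X × A)) : Stream' (Stream' (X × A) × A) :=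
  fun n => (σ.drop n, (σ n).2)

/-- The first transition of a stream: its first label together with its second state. -/
def firstTrans {A Z : Type} (s : Stream' (Z × A)) : A × Z := ((s 0).2, (s 1).1)

/-- A distributive law of the free monad `Σ*` over the cofree comonad `B^∞`
for the stream behaviour `B X = A × X`: a natural family
`λ_X : Σ*(B^∞ X) → B^∞(Σ* X)` satisfying the four axioms (i)-(iv). -/
structure DistLaw (Op : Type) (ar : Op → ℕ) (A : Type) : Type 1 where
  law : ∀ X : Type, Term Op ar (Stream' (X × A)) → Stream' (Term Op ar X × A)
  natural : ∀ (X Y : Type) (f : X → Y) (u : Term Op ar (Stream' (X × A))),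
      law Y (u.map (Stream'.map (Prod.map f id))) =
        Stream'.map (Prod.map (Term.map f) id) (law X u)
  /-- (i): on a bare stream, `λ` returns the same stream, states regarded as terms. -/
  ax_unit : ∀ (X : Type) (σ : Stream' (X × A)),
      law X (Term.var σ) = Stream'.map (Prod.map Term.var id) σ
  /-- (ii): the first state of `λ_X u` is `u` with each stream replaced by its first state. -/
  ax_counit : ∀ (X : Type) (u : Term Op ar (Stream' (X × A))),
      (law X u 0).1 = u.map fun σ => (σ 0).1
  /-- (iii): compositionality with respect to terms. -/
  ax_mult : ∀ (X : Type) (u : Term Op ar (Term Op ar (Stream' (X × A)))),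
      law X u.join =
        Stream'.map (Prod.map Term.join id) (law (Term Op ar X) (u.map (law X)))
  /-- (iv): decompositionality with respect to streams (`δΣ* ∘ λ = B^∞λ ∘ λB^∞ ∘ Σ*δ`):
  applying `λ_X` to the n-th state of `λ_X u`, with each variable occurrence replaced by
  the residual input stream starting at it, yields the n-th tail of `λ_X u`. -/
  ax_comult : ∀ (X : Type) (u : Term Op ar (Stream' (X × A))),
      Stream'.map (Prod.map (law X) id) (law (Stream' (X × A)) (u.map sTails)) =
        sTails (law X u)

/-- The signature with one constant `C` (symbol `false`) and one unary operation
symbol `q` (symbol `true`). -/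
def cqAr : Bool → ℕ
  | false => 0
  | true => 1

/-- The constant term `C`. -/
def CT (X : Type) : Term Bool cqAr X := Term.op false Fin.elim0

/-- Application of the unary operation symbol `q`. -/
def qT {X : Type} (t : Term Bool cqAr X) : Term Bool cqAr X := Term.op true fun _ => t

theorem CT_map {X Y : Type} (f : X → Y) : (CT X).map f = CT Y := by
  show Term.op false _ = Term.op false _
  congr 1
  funext i
  exact Fin.elim0 i

theorem qT_ne {X : Type} (t : Term Bool cqAr X) : t ≠ qT t := by
  induction t with
  | var x => intro h; cases h
  | op o ts ih =>
    intro h0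
    have h := h0
    unfold qT at h
    injection h with h1 h2
    subst h1
    have h3 := congrFun (eq_of_heq h2) (0 : Fin 1)
    refine ih (0 : Fin 1) ?_
    have h4 : ts (0 : Fin 1) = Term.op true ts := h3
    rw [h4]
    exact h0

/-- Let `A` be a set of labels with a chosen element `$ ∈ A`, and consider the signature
with one constant `C` and one unary operation symbol `q`. For the biGSOS law `ρ` given by
`ρ_X(C) = ($, q(C))` and `ρ_X(q(x0 →a0 x1 →a1 x2 →a2 ⋯)) = (a1, q(x2))`, there exists
no distributive law `λ` that extends `ρ`. -/
theorem no_distLaw_extends (A : Type) (dollar : A) :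
    ¬ ∃ lam : DistLaw Bool cqAr A,
      (∀ X : Type, firstTrans (lam.law X (CT (Stream' (X × A)))) = (dollar, qT (CT X))) ∧
      (∀ (X : Type) (σ : Stream' (X × A)),
        firstTrans (lam.law X (qT (Term.var σ))) = ((σ 1).2, qT (Term.var (σ 2).1))) := by
  rintro ⟨lam, hC, hq⟩
  have h1 := congrFun (lam.ax_comult Unit (CT _)) 1
  rw [CT_map] at h1
  have h2 := congrArg Prod.snd (hC (Stream' (Unit × A)))
  have h3 : lam.law Unit (lam.law (Stream' (Unit × A)) (CT _) 1).1
      = (lam.law Unit (CT _)).drop 1 := congrArg Prod.fst h1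
  have h2' : (lam.law (Stream' (Unit × A)) (CT _) 1).1 = qT (CT _) := h2
  rw [h2'] at h3
  have h4 := lam.ax_mult Unit (qT (Term.var (CT _)))
  have h5 : (qT (Term.var (CT (Stream' (Unit × A))))).join = qT (CT _) := rfl
  rw [h5, h3] at h4
  have h6 := congrArg Prod.fst (congrFun h4 1)
  have h7 : (lam.law (Term Bool cqAr Unit) (qT (Term.var (lam.law Unit (CT _)))) 1).1
      = qT (Term.var (lam.law Unit (CT _) 2).1) := congrArg Prod.snd (hq _ _)
  have h8 : (lam.law Unit (CT _) 2).1 =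
    (lam.law (Term Bool cqAr Unit) (qT (Term.var (lam.law Unit (CT _)))) 1).1.join := h6
  rw [h7] at h8
  exact qT_ne _ h8
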